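/- Let N ≥ 3, let i ∈ {2,…,N−1}, and let Γ : ℝ → ℝ be 2π-periodic, twice differentiable on (0, 2π), with Γ′(θ) < 0 for every θ ∈ (0, 2π), and with second derivative of constant sign on (0, 2π). Let I ⊆ ℝ be an interval and let Θ, Ψ : I → ℝ^{N−1} be curves whose (i−1)-th and i-th components coincide identically (Θ_{i−1}(t) = Θ_i(t) and Ψ_{i−1}(t) = Ψ_i(t) for all t ∈ I), whose components indexed by k ∈ {1,…,N−1}\{i−1} solve the reduced C′ᵢ dynamics on I, and which satisfy Θ(t) ∈ C′ᵢ, Ψ(t) ∈ C′ᵢ and Θ(t) ≠ Ψ(t) for every t ∈ I. Then the function t ↦ ‖Θ(t) − Ψ(t)‖_{(1)} is strictly decreasing on I. -/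

import Mathlib

open Real Filter Set Topology

noncomputable section

/-- Right-hand side of the reduced `C′ᵢ` dynamics for a component `k ∉ {i-1, i}`:
`Γ(x_k) + Σ_{j∈{1..N-1}\{k,i-1,i}} Γ(x_k-x_j) + 2Γ(x_k-x_i) - Σ_{j∈{1..N-1}\{i-1,i}} Γ(-x_j) - 2Γ(-x_i)`. -/
def redRHSi (N i : ℕ) (Γ : ℝ → ℝ) (x : ℕ → ℝ) (k : ℕ) : ℝ :=
  Γ (x k) + ∑ j ∈ Finset.Icc 1 (N - 1) \ {k, i - 1, i}, Γ (x k - x j)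
    + 2 * Γ (x k - x i)
    - ∑ j ∈ Finset.Icc 1 (N - 1) \ {i - 1, i}, Γ (-(x j)) - 2 * Γ (-(x i))

/-- Right-hand side of the reduced `C′ᵢ` dynamics for the component `i`:
`Γ(x_i) + Σ_{j∈{1..N-1}\{i-1,i}} Γ(x_i-x_j) + Γ(0) - Σ_{j∈{1..N-1}\{i-1,i}} Γ(-x_j) - 2Γ(-x_i)`. -/
def redRHSii (N i : ℕ) (Γ : ℝ → ℝ) (x : ℕ → ℝ) : ℝ :=
  Γ (x i) + ∑ j ∈ Finset.Icc 1 (N - 1) \ {i - 1, i}, Γ (x i - x j)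
    + Γ 0
    - ∑ j ∈ Finset.Icc 1 (N - 1) \ {i - 1, i}, Γ (-(x j)) - 2 * Γ (-(x i))

/-- The components of `Θ` indexed by `k ∈ {1,…,N-1} \ {i-1}` solve the reduced `C′ᵢ`
dynamics on `I`. -/
def IsSolRedi (N i : ℕ) (Γ : ℝ → ℝ) (I : Set ℝ) (Θ : ℝ → ℕ → ℝ) : Prop :=
  (∀ k ∈ Finset.Icc 1 (N - 1), k ≠ i - 1 → k ≠ i → ∀ t ∈ I,
    HasDerivAt (fun s => Θ s k) (redRHSi N i Γ (Θ t) k) t) ∧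
  (∀ t ∈ I, HasDerivAt (fun s => Θ s i) (redRHSii N i Γ (Θ t)) t)

/-- The open cone `C′ᵢ = {0 < x₁ < … < x_{i-2} < x_{i-1} = x_i < x_{i+1} < … < x_{N-1} < 2π}`. -/
def inConeRedi (N i : ℕ) (x : ℕ → ℝ) : Prop :=
  0 < x 1 ∧ (∀ k ∈ Finset.Icc 1 (N - 2), k ≠ i - 1 → x k < x (k + 1)) ∧
    x (i - 1) = x i ∧ x (N - 1) < 2 * π

/-- The 1-norm (total variation) distance between the vectors with components `a,…,b` of `x,y`. -/
def dist1 (a b : ℕ) (x y : ℕ → ℝ) : ℝ :=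
  |x a - y a| + ∑ j ∈ Finset.Icc a (b - 1), |x (j + 1) - y (j + 1) - (x j - y j)|
    + |x b - y b|

/-- Weighted sums of increments are bounded below by the variation, for nondecreasing weights. -/
theorem weighted_variation_le_of_monotone (n : ℕ) : ∀ (c e s : ℕ → ℝ), Monotone c → e n = 0 →
    (∀ m, |s m| ≤ 1) → (∀ m, s m * (e (m + 1) - e m) = |e (m + 1) - e m|) →
    |e 0| ≤ ∑ m ∈ Finset.range n, |e (m + 1) - e m| ∧
    c 0 * ∑ m ∈ Finset.range n, |e (m + 1) - e m| ≤
      ∑ m ∈ Finset.range n, s m * (c (m + 1) * e (m + 1) - c m * e m) := by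
  induction n with
  | zero => intro c e s _ he _ _; simp [he]
  | succ n ih =>
    intro c e s hc he hs hse
    obtain ⟨h1, h2⟩ := ih (fun m => c (m + 1)) (fun m => e (m + 1)) (fun m => s (m + 1))
      (fun a b hab => hc (by omega)) he (fun m => hs _) (fun m => hse _)
    rw [Finset.sum_range_succ', Finset.sum_range_succ']
    simp only [zero_add] at h1 h2 ⊢
    set T := ∑ m ∈ Finset.range n, |e (m + 1 + 1) - e (m + 1)|
    have hc01 : c 0 ≤ c 1 := hc (by omega)
    constructor
    · have := abs_sub_abs_le_abs_sub (e 0) (e 1)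
      rw [abs_sub_comm] at this
      linarith
    · have h3 : -|e 1| ≤ s 0 * e 1 := by
        have : |s 0 * e 1| ≤ |e 1| := by
          rw [abs_mul]; exact mul_le_of_le_one_left (abs_nonneg _) (hs 0)
        linarith [neg_abs_le (s 0 * e 1)]
      have h4 : (c 1 - c 0) * (-T) ≤ (c 1 - c 0) * (s 0 * e 1) :=
        mul_le_mul_of_nonneg_left (by linarith) (by linarith)
      have h5 := hse 0
      simp only [zero_add] at h5
      have h6 : s 0 * (c 1 * e 1 - c 0 * e 0)
          = c 0 * |e 1 - e 0| + (c 1 - c 0) * (s 0 * e 1) := by rw [← h5]; ring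
      rw [h6]
      linarith

/-- Weighted sums of increments are bounded below by the variation, for nonincreasing weights. -/
theorem weighted_variation_le_of_antitone (c e s : ℕ → ℝ) (hc : Antitone c) (he : e 0 = 0)
    (hs : ∀ m, |s m| ≤ 1) (hse : ∀ m, s m * (e (m + 1) - e m) = |e (m + 1) - e m|) (n : ℕ) :
    |e n| ≤ ∑ m ∈ Finset.range n, |e (m + 1) - e m| ∧
    c n * ∑ m ∈ Finset.range n, |e (m + 1) - e m| ≤
      ∑ m ∈ Finset.range n, s m * (c (m + 1) * e (m + 1) - c m * e m) := by
  induction n with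
  | zero => simp [he]
  | succ n ih =>
    obtain ⟨h1, h2⟩ := ih
    rw [Finset.sum_range_succ, Finset.sum_range_succ]
    set T := ∑ m ∈ Finset.range n, |e (m + 1) - e m|
    have hcn : c (n + 1) ≤ c n := hc (by omega)
    constructor
    · have := abs_sub_abs_le_abs_sub (e (n + 1)) (e n)
      linarith
    · have h3 : s n * e n ≤ |e n| := by
        have : |s n * e n| ≤ |e n| := by
          rw [abs_mul]; exact mul_le_of_le_one_left (abs_nonneg _) (hs n)
        linarith [le_abs_self (s n * e n)]
      have h4 : (c n - c (n + 1)) * (s n * e n) ≤ (c n - c (n + 1)) * T :=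
        mul_le_mul_of_nonneg_left (by linarith) (by linarith)
      have h6 : s n * (c (n + 1) * e (n + 1) - c n * e n)
          = c (n + 1) * |e (n + 1) - e n| - (c n - c (n + 1)) * (s n * e n) := by
        rw [← hse n]; ring
      rw [h6]
      linarith

/-- The mean of `-g` over the segment from `b` to `a`. -/
def negMean (g : ℝ → ℝ) (a b : ℝ) : ℝ := ∫ r in (0 : ℝ)..1, -g (b + r * (a - b))

section NegMean

variable {Γ Γ' Γ'' : ℝ → ℝ} {L : ℝ}

theorem segment_mem_Ioo {a b r : ℝ} (ha : a ∈ Ioo 0 L) (hb : b ∈ Ioo 0 L)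
    (hr : r ∈ Icc (0 : ℝ) 1) : b + r * (a - b) ∈ Ioo 0 L := by
  have h := (convex_Ioo 0 L) hb ha (sub_nonneg.2 hr.2) hr.1 (by ring)
  simp only [smul_eq_mul] at h
  convert h using 1
  ring

theorem continuousOn_segment (hd2 : ∀ θ ∈ Ioo 0 L, HasDerivAt Γ' (Γ'' θ) θ) {a b : ℝ}
    (ha : a ∈ Ioo 0 L) (hb : b ∈ Ioo 0 L) :
    ContinuousOn (fun r : ℝ => -Γ' (b + r * (a - b))) (Icc 0 1) := by
  have h : ContinuousOn Γ' (Ioo 0 L) := fun θ hθ => (hd2 θ hθ).continuousAt.continuousWithinAt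
  exact (h.comp (by fun_prop) fun r hr => segment_mem_Ioo ha hb hr).neg

theorem intervalIntegrable_segment (hd2 : ∀ θ ∈ Ioo 0 L, HasDerivAt Γ' (Γ'' θ) θ) {a b : ℝ}
    (ha : a ∈ Ioo 0 L) (hb : b ∈ Ioo 0 L) :
    IntervalIntegrable (fun r : ℝ => -Γ' (b + r * (a - b))) MeasureTheory.volume 0 1 := by
  apply ContinuousOn.intervalIntegrable
  rw [uIcc_of_le zero_le_one]
  exact continuousOn_segment hd2 ha hb

theorem negMean_mul_sub (hd1 : ∀ θ ∈ Ioo 0 L, HasDerivAt Γ (Γ' θ) θ)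
    (hd2 : ∀ θ ∈ Ioo 0 L, HasDerivAt Γ' (Γ'' θ) θ) {a b : ℝ}
    (ha : a ∈ Ioo 0 L) (hb : b ∈ Ioo 0 L) :
    negMean Γ' a b * (a - b) = Γ b - Γ a := by
  have h := intervalIntegral.integral_eq_sub_of_hasDerivAt
    (a := 0) (b := 1) (f := fun r => -Γ (b + r * (a - b)))
    (f' := fun r => -Γ' (b + r * (a - b)) * (a - b)) ?_
    ((intervalIntegrable_segment hd2 ha hb).mul_const _)
  · rw [intervalIntegral.integral_mul_const] at h
    rw [negMean, h]
    simp only [one_mul, zero_mul, add_zero, add_sub_cancel]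
    ring
  · intro r hr
    rw [uIcc_of_le zero_le_one] at hr
    have h1 : HasDerivAt (fun r : ℝ => b + r * (a - b)) (a - b) r := by
      simpa using ((hasDerivAt_id r).mul_const (a - b)).const_add b
    have h2 := ((hd1 _ (segment_mem_Ioo ha hb hr)).comp r h1).neg
    rw [← neg_mul] at h2
    exact h2

theorem negMean_pos (hd2 : ∀ θ ∈ Ioo 0 L, HasDerivAt Γ' (Γ'' θ) θ)
    (hneg : ∀ θ ∈ Ioo 0 L, Γ' θ < 0) {a b : ℝ} (ha : a ∈ Ioo 0 L) (hb : b ∈ Ioo 0 L) :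
    0 < negMean Γ' a b :=
  intervalIntegral.intervalIntegral_pos_of_pos_on (intervalIntegrable_segment hd2 ha hb)
    (fun _ hr => neg_pos.2 (hneg _ (segment_mem_Ioo ha hb (Ioo_subset_Icc_self hr)))) zero_lt_one

theorem segment_le {a b a' b' r : ℝ} (haa : a ≤ a') (hbb : b ≤ b') (hr : r ∈ Icc (0 : ℝ) 1) :
    b + r * (a - b) ≤ b' + r * (a' - b') := by
  nlinarith [mul_le_mul_of_nonneg_left haa hr.1,
    mul_le_mul_of_nonneg_left hbb (sub_nonneg.2 hr.2)]

theorem negMean_le_of_antitoneOn (hd2 : ∀ θ ∈ Ioo 0 L, HasDerivAt Γ' (Γ'' θ) θ)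
    (hΓ' : AntitoneOn Γ' (Ioo 0 L)) {a b a' b' : ℝ} (ha : a ∈ Ioo 0 L) (hb : b ∈ Ioo 0 L)
    (ha' : a' ∈ Ioo 0 L) (hb' : b' ∈ Ioo 0 L) (haa : a ≤ a') (hbb : b ≤ b') :
    negMean Γ' a b ≤ negMean Γ' a' b' :=
  intervalIntegral.integral_mono_on zero_le_one (intervalIntegrable_segment hd2 ha hb)
    (intervalIntegrable_segment hd2 ha' hb') fun _ hr =>
    neg_le_neg (hΓ' (segment_mem_Ioo ha hb hr) (segment_mem_Ioo ha' hb' hr)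
      (segment_le haa hbb hr))

theorem negMean_le_of_monotoneOn (hd2 : ∀ θ ∈ Ioo 0 L, HasDerivAt Γ' (Γ'' θ) θ)
    (hΓ' : MonotoneOn Γ' (Ioo 0 L)) {a b a' b' : ℝ} (ha : a ∈ Ioo 0 L) (hb : b ∈ Ioo 0 L)
    (ha' : a' ∈ Ioo 0 L) (hb' : b' ∈ Ioo 0 L) (haa : a ≤ a') (hbb : b ≤ b') :
    negMean Γ' a' b' ≤ negMean Γ' a b :=
  intervalIntegral.integral_mono_on zero_le_one (intervalIntegrable_segment hd2 ha' hb')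
    (intervalIntegrable_segment hd2 ha hb) fun _ hr =>
    neg_le_neg (hΓ' (segment_mem_Ioo ha hb hr) (segment_mem_Ioo ha' hb' hr)
      (segment_le haa hbb hr))

theorem antitoneOn_or_monotoneOn_of_hasDerivAt
    (hd2 : ∀ θ ∈ Ioo 0 L, HasDerivAt Γ' (Γ'' θ) θ)
    (hcurv : (∀ θ ∈ Ioo 0 L, 0 ≤ Γ'' θ) ∨ (∀ θ ∈ Ioo 0 L, Γ'' θ ≤ 0)) :
    MonotoneOn Γ' (Ioo 0 L) ∨ AntitoneOn Γ' (Ioo 0 L) := by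
  have hc : ContinuousOn Γ' (Ioo 0 L) := fun θ hθ => (hd2 θ hθ).continuousAt.continuousWithinAt
  have hw : ∀ θ ∈ interior (Ioo 0 L), HasDerivWithinAt Γ' (Γ'' θ) (interior (Ioo 0 L)) θ := by
    rw [interior_Ioo]
    exact fun θ hθ => (hd2 θ hθ).hasDerivWithinAt
  refine hcurv.imp (fun h => ?_) (fun h => ?_)
  · refine monotoneOn_of_hasDerivWithinAt_nonneg (convex_Ioo _ _) hc hw ?_
    rwa [interior_Ioo]
  · refine antitoneOn_of_hasDerivWithinAt_nonpos (convex_Ioo _ _) hc hw ?_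
    rwa [interior_Ioo]

/-- Two nondecreasing chains of phases that differ somewhere: the increments of the coupling,
weighted by the signs of the increments of the difference, have a positive sum. -/
theorem signed_coupling_increments_pos (hd1 : ∀ θ ∈ Ioo 0 L, HasDerivAt Γ (Γ' θ) θ)
    (hd2 : ∀ θ ∈ Ioo 0 L, HasDerivAt Γ' (Γ'' θ) θ)
    (hneg : ∀ θ ∈ Ioo 0 L, Γ' θ < 0)
    (hcurv : (∀ θ ∈ Ioo 0 L, 0 ≤ Γ'' θ) ∨ (∀ θ ∈ Ioo 0 L, Γ'' θ ≤ 0))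
    {a b s : ℕ → ℝ} {n lo hi : ℕ} (hlohi : lo ≤ hi) (h0lo : 0 < lo) (hhin : hi < n)
    (ha : Monotone a) (hb : Monotone b)
    (hint : ∀ m, lo ≤ m → m ≤ hi → a m ∈ Ioo 0 L ∧ b m ∈ Ioo 0 L)
    (hout : ∀ m ≤ n, ¬ (lo ≤ m ∧ m ≤ hi) → a m = b m)
    (hs : ∀ m, |s m| ≤ 1)
    (hse : ∀ m, s m * (a (m + 1) - b (m + 1) - (a m - b m))
      = |a (m + 1) - b (m + 1) - (a m - b m)|)
    (hne : ∃ m ≤ n, a m ≠ b m) :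
    0 < ∑ m ∈ Finset.range n, s m * (Γ (b (m + 1)) - Γ (a (m + 1)) - (Γ (b m) - Γ (a m))) := by
  set p : ℕ → ℕ := fun m => max lo (min m hi) with hp
  have hpm : Monotone p := fun x y hxy => max_le_max le_rfl (min_le_min hxy le_rfl)
  have hpi : ∀ m, a (p m) ∈ Ioo 0 L ∧ b (p m) ∈ Ioo 0 L :=
    fun m => hint _ (le_max_left _ _) (max_le hlohi (min_le_right _ _))
  set c : ℕ → ℝ := fun m => negMean Γ' (a (p m)) (b (p m)) with hc
  have hcpos : ∀ m, 0 < c m := fun m => negMean_pos hd2 hneg (hpi m).1 (hpi m).2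
  set e : ℕ → ℝ := fun m => a m - b m with he
  have hg : ∀ m ≤ n, Γ (b m) - Γ (a m) = c m * e m := by
    intro m hm
    by_cases h : lo ≤ m ∧ m ≤ hi
    · have : p m = m := by simp only [hp]; omega
      simp only [hc, he, this]
      exact (negMean_mul_sub hd1 hd2 (hint m h.1 h.2).1 (hint m h.1 h.2).2).symm
    · simp [he, hout m hm h]
  have he0 : e 0 = 0 := sub_eq_zero.2 (hout 0 (Nat.zero_le _) (by omega))
  have hen : e n = 0 := sub_eq_zero.2 (hout n le_rfl (by omega))
  have hsum : ∑ m ∈ Finset.range n, s m * (Γ (b (m + 1)) - Γ (a (m + 1)) - (Γ (b m) - Γ (a m)))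
      = ∑ m ∈ Finset.range n, s m * (c (m + 1) * e (m + 1) - c m * e m) := by
    refine Finset.sum_congr rfl fun m hm => ?_
    rw [Finset.mem_range] at hm
    rw [hg m hm.le, hg (m + 1) hm]
  rw [hsum]
  have hT : 0 < ∑ m ∈ Finset.range n, |e (m + 1) - e m| := by
    refine lt_of_le_of_ne (Finset.sum_nonneg fun _ _ => abs_nonneg _) fun h => ?_
    have hz := (Finset.sum_eq_zero_iff_of_nonneg fun _ _ => abs_nonneg _).1 h.symm
    obtain ⟨m, hm, hme⟩ := hne
    apply hme
    have : ∀ k ≤ n, e k = 0 := by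
      intro k
      induction k with
      | zero => intro _; exact he0
      | succ k ih =>
        intro hk
        have := abs_eq_zero.1 (hz k (Finset.mem_range.2 hk))
        linarith [ih (by omega)]
    exact sub_eq_zero.1 (this m hm)
  rcases antitoneOn_or_monotoneOn_of_hasDerivAt hd2 hcurv with h | h
  · have hca : Antitone c := fun x y hxy =>
      negMean_le_of_monotoneOn hd2 h (hpi x).1 (hpi x).2 (hpi y).1 (hpi y).2
        (ha (hpm hxy)) (hb (hpm hxy))
    exact (mul_pos (hcpos n) hT).trans_le
      (weighted_variation_le_of_antitone c e s hca he0 hs hse n).2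
  · have hcm : Monotone c := fun x y hxy =>
      negMean_le_of_antitoneOn hd2 h (hpi x).1 (hpi x).2 (hpi y).1 (hpi y).2
        (ha (hpm hxy)) (hb (hpm hxy))
    exact (mul_pos (hcpos 0) hT).trans_le
      (weighted_variation_le_of_monotone n c e s hcm hen hs hse).2

end NegMean

theorem sum_range_add_eq_of_periodic {F : ℕ → ℝ} {N : ℕ} (hF : ∀ k, F (k + N) = F k) (j : ℕ) :
    ∑ m ∈ Finset.range N, F (j + m) = ∑ m ∈ Finset.range N, F m := by
  induction j with
  | zero => simp
  | succ j ih =>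
    rw [← ih]
    have h1 := Finset.sum_range_succ (fun m => F (j + m)) N
    have h2 := Finset.sum_range_succ' (fun m => F (j + m)) N
    simp only [add_zero, hF] at h1 h2
    have h3 : ∑ m ∈ Finset.range N, F (j + 1 + m) = ∑ m ∈ Finset.range N, F (j + (m + 1)) :=
      Finset.sum_congr rfl fun m _ => by congr 1; omega
    linarith

/-- The right derivative of the absolute value of a right-differentiable function. -/
theorem exists_sign_hasDerivWithinAt_abs {d : ℝ → ℝ} {d' t : ℝ}
    (h : HasDerivWithinAt d d' (Ici t) t) :
    ∃ s : ℝ, |s| ≤ 1 ∧ s * d t = |d t| ∧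
      HasDerivWithinAt (fun u => |d u|) (s * d') (Ici t) t := by
  rcases lt_trichotomy (d t) 0 with hd | hd | hd
  · refine ⟨-1, by simp, by rw [abs_of_neg hd]; ring, ?_⟩
    exact (hasDerivAt_abs_neg hd).comp_hasDerivWithinAt t h
  · have key : HasDerivWithinAt (fun u => |d u|) |d'| (Ici t) t := by
      rw [hasDerivWithinAt_iff_tendsto_slope] at h ⊢
      refine h.abs.congr' ?_
      filter_upwards [self_mem_nhdsWithin] with u hu
      have hu' : t ≤ u := hu.1
      rw [slope_def_field, slope_def_field, hd, abs_div, abs_of_nonneg (sub_nonneg.2 hu')]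
      simp
    rcases le_total 0 d' with h0 | h0
    · exact ⟨1, by simp, by simp [hd], by rwa [abs_of_nonneg h0, ← one_mul d'] at key⟩
    · exact ⟨-1, by simp, by simp [hd], by rwa [abs_of_nonpos h0, neg_eq_neg_one_mul] at key⟩
  · refine ⟨1, by simp, by rw [abs_of_pos hd]; ring, ?_⟩
    exact (hasDerivAt_abs_pos hd).comp_hasDerivWithinAt t h

theorem lt_of_right_deriv_neg {f f' : ℝ → ℝ} {a b : ℝ} (hab : a < b)
    (hf : ContinuousOn f (Icc a b))
    (hf' : ∀ t ∈ Ico a b, HasDerivWithinAt f (f' t) (Ici t) t)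
    (hneg : ∀ t ∈ Ico a b, f' t < 0) : f b < f a := by
  have ha := hf' a (left_mem_Ico.2 hab)
  rw [hasDerivWithinAt_iff_tendsto_slope, Ici_sdiff_left] at ha
  have h1 := ha.eventually (gt_mem_nhds (hneg a (left_mem_Ico.2 hab)))
  have h2 : ∀ᶠ u in 𝓝[>] a, u ∈ Ioo a b := Ioo_mem_nhdsGT hab
  obtain ⟨u, hu, hua⟩ := (h1.and h2).exists
  have h3 : f u < f a := by
    rw [slope_def_field, div_neg_iff] at hu
    rcases hu with hu | hu
    · linarith [hua.1, hu.2]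
    · linarith [hu.1]
  have h4 := image_le_of_deriv_right_le_deriv_boundary (f := f) (f' := f') (a := u) (b := b)
    (B := fun _ => f u) (B' := fun _ => 0) (hf.mono (Icc_subset_Icc_left hua.1.le))
    (fun t ht => hf' t ⟨hua.1.le.trans ht.1, ht.2⟩) le_rfl continuousOn_const
    (fun t _ => hasDerivWithinAt_const _ _ _)
    (fun t ht => (hneg t ⟨hua.1.le.trans ht.1, ht.2⟩).le)
  exact (h4 (right_mem_Icc.2 hua.2.le)).trans_lt h3

/-- The phases `0, x₁, …, x_{N-1}` extended along the circle by `X (k + N) = X k + 2π`. -/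
def cyclicExt (N : ℕ) (x : ℕ → ℝ) (k : ℕ) : ℝ :=
  (if k % N = 0 then 0 else x (k % N)) + 2 * π * (k / N : ℕ)

section Cyclic

variable {N i : ℕ} {Γ Γ' Γ'' : ℝ → ℝ} {x y : ℕ → ℝ}

theorem cyclicExt_add (hN : 0 < N) (x : ℕ → ℝ) (k : ℕ) :
    cyclicExt N x (k + N) = cyclicExt N x k + 2 * π := by
  simp only [cyclicExt, Nat.add_mod_right, Nat.add_div_right k hN]
  push_cast
  ring

theorem cyclicExt_zero : cyclicExt N x 0 = 0 := by simp [cyclicExt]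

theorem cyclicExt_self (hN : 0 < N) : cyclicExt N x N = 2 * π := by
  simpa [cyclicExt_zero] using cyclicExt_add hN x 0

theorem cyclicExt_of_lt {k : ℕ} (hk0 : 0 < k) (hk : k < N) : cyclicExt N x k = x k := by
  simp [cyclicExt, Nat.mod_eq_of_lt hk, Nat.div_eq_of_lt hk, hk0.ne']

theorem cyclicExt_step_lt (hN : 3 ≤ N) (h : inConeRedi N i x) {k : ℕ}
    (hk : k < N) (hki : k ≠ i - 1) :
    cyclicExt N x k < cyclicExt N x (k + 1) := by
  obtain ⟨h1, h2, h3, h4⟩ := h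
  rcases Nat.eq_zero_or_pos k with rfl | hk0
  · rw [cyclicExt_zero, cyclicExt_of_lt (by omega) (by omega)]; exact h1
  · rw [cyclicExt_of_lt hk0 hk]
    rcases Nat.lt_or_ge (k + 1) N with hk' | hk'
    · rw [cyclicExt_of_lt (by omega) hk']
      exact h2 k (Finset.mem_Icc.2 ⟨hk0, by omega⟩) hki
    · have hkN : k + 1 = N := by omega
      rw [hkN, cyclicExt_self (by omega)]
      obtain rfl : k = N - 1 := by omega
      exact h4

theorem cyclicExt_step_eq (h : inConeRedi N i x) (hi : 2 ≤ i) (hi' : i < N) :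
    cyclicExt N x i = cyclicExt N x (i - 1) := by
  rw [cyclicExt_of_lt (by omega) hi', cyclicExt_of_lt (by omega) (by omega)]
  exact h.2.2.1.symm

theorem cyclicExt_monotone (hN : 3 ≤ N) (h : inConeRedi N i x) (hi : 2 ≤ i) (hi' : i < N) :
    Monotone (cyclicExt N x) := by
  have hlt : ∀ k < N, cyclicExt N x k ≤ cyclicExt N x (k + 1) := by
    intro k hk
    by_cases hki : k = i - 1
    · subst hki
      rw [show i - 1 + 1 = i by omega, cyclicExt_step_eq h hi hi']
    · exact (cyclicExt_step_lt hN h hk hki).le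
  refine monotone_nat_of_le_succ fun k => ?_
  induction k using Nat.strong_induction_on with
  | _ k ih =>
    rcases Nat.lt_or_ge k N with hk | hk
    · exact hlt k hk
    · obtain ⟨m, rfl⟩ := Nat.exists_eq_add_of_le' hk
      have := ih m (by omega)
      rw [show m + N + 1 = m + 1 + N by omega, cyclicExt_add (by omega), cyclicExt_add (by omega)]
      linarith

theorem cyclicExt_sub_mem_Ioo (hN : 3 ≤ N) (h : inConeRedi N i x) (hi : 2 ≤ i) (hi' : i < N)
    {j m : ℕ} (hj : j < N) (hm : 0 < m) (hmN : m < N) (h1 : j = i - 1 → 2 ≤ m)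
    (h2 : j = i → m + 2 ≤ N) :
    cyclicExt N x (j + m) - cyclicExt N x j ∈ Ioo 0 (2 * π) := by
  have hmono := cyclicExt_monotone hN h hi hi'
  constructor
  · rw [sub_pos]
    by_cases hji : j = i - 1
    · have h3 := h1 hji
      calc cyclicExt N x j ≤ cyclicExt N x (j + 1) := hmono (by omega)
        _ < cyclicExt N x (j + 1 + 1) := cyclicExt_step_lt hN h (by omega) (by omega)
        _ ≤ _ := hmono (by omega)
    · exact (cyclicExt_step_lt hN h hj hji).trans_le (hmono (by omega))
  · have hlast : cyclicExt N x (j + m) < cyclicExt N x (j + N) := by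
      by_cases hji : j = i
      · have h3 := h2 hji
        have h4 := cyclicExt_step_lt hN h (k := j - 2) (by omega) (by omega)
        calc cyclicExt N x (j + m) ≤ cyclicExt N x (j - 2 + N) := hmono (by omega)
          _ < cyclicExt N x (j - 2 + 1 + N) := by
            rw [cyclicExt_add (by omega), cyclicExt_add (by omega)]; linarith
          _ ≤ _ := hmono (by omega)
      · rcases Nat.eq_zero_or_pos j with rfl | hj0
        · have h4 := cyclicExt_step_lt hN h (k := N - 1)
          by_cases hiN : N - 1 = i - 1
          · omega
          · calc cyclicExt N x (0 + m) ≤ cyclicExt N x (N - 1) := hmono (by omega)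
              _ < cyclicExt N x (N - 1 + 1) := h4 (by omega) hiN
              _ ≤ _ := hmono (by omega)
        · have h4 := cyclicExt_step_lt hN h (k := j - 1) (by omega) (by omega)
          calc cyclicExt N x (j + m) ≤ cyclicExt N x (j - 1 + N) := hmono (by omega)
            _ < cyclicExt N x (j - 1 + 1 + N) := by
              rw [cyclicExt_add (by omega), cyclicExt_add (by omega)]; linarith
            _ ≤ _ := hmono (by omega)
    rw [cyclicExt_add (by omega)] at hlast
    linarith

/-- The common velocity field of all phases, relative to phase `0`. -/
def cyclicField (N : ℕ) (Γ : ℝ → ℝ) (x : ℕ → ℝ) (k : ℕ) : ℝ :=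
  ∑ j ∈ Finset.range N, Γ (cyclicExt N x k - cyclicExt N x j)
    - ∑ j ∈ Finset.range N, Γ (-cyclicExt N x j)

theorem sum_range_cyclicExt (hN : 3 ≤ N) (hi : 2 ≤ i) (hi' : i < N) (F : ℝ → ℝ)
    (hx : x (i - 1) = x i) :
    ∑ j ∈ Finset.range N, F (cyclicExt N x j) =
      F 0 + ∑ j ∈ Finset.Icc 1 (N - 1) \ {i - 1, i}, F (x j) + 2 * F (x i) := by
  have h1 : Finset.range N = insert 0 (Finset.Icc 1 (N - 1)) := by
    ext k; simp only [Finset.mem_range, Finset.mem_insert, Finset.mem_Icc]; omega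
  have hsub : ({i - 1, i} : Finset ℕ) ⊆ Finset.Icc 1 (N - 1) := by
    intro k; simp only [Finset.mem_insert, Finset.mem_singleton, Finset.mem_Icc]; omega
  have h2 : ∑ j ∈ Finset.Icc 1 (N - 1), F (cyclicExt N x j)
      = ∑ j ∈ Finset.Icc 1 (N - 1), F (x j) := by
    refine Finset.sum_congr rfl fun j hj => ?_
    rw [Finset.mem_Icc] at hj
    rw [cyclicExt_of_lt (by omega) (by omega)]
  rw [h1, Finset.sum_insert (by simp), cyclicExt_zero, h2, ← Finset.sum_sdiff hsub,
    Finset.sum_pair (by omega), hx]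
  ring

theorem redRHSii_eq_cyclicField (hN : 3 ≤ N) (hi : 2 ≤ i) (hi' : i < N)
    (hx : x (i - 1) = x i) : redRHSii N i Γ x = cyclicField N Γ x i := by
  rw [cyclicField, sum_range_cyclicExt hN hi hi' (fun u => Γ (cyclicExt N x i - u)) hx,
    sum_range_cyclicExt hN hi hi' (fun u => Γ (-u)) hx, cyclicExt_of_lt (by omega) hi', redRHSii]
  simp only [sub_zero, sub_self, neg_zero]
  ring

theorem redRHSi_eq_cyclicField (hN : 3 ≤ N) (hi : 2 ≤ i) (hi' : i < N)
    (hx : x (i - 1) = x i) {k : ℕ} (hk0 : 0 < k) (hk : k < N) (hk1 : k ≠ i - 1) (hk2 : k ≠ i) :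
    redRHSi N i Γ x k = cyclicField N Γ x k := by
  rw [cyclicField, sum_range_cyclicExt hN hi hi' (fun u => Γ (cyclicExt N x k - u)) hx,
    sum_range_cyclicExt hN hi hi' (fun u => Γ (-u)) hx, cyclicExt_of_lt hk0 hk, redRHSi]
  have h : Finset.Icc 1 (N - 1) \ {i - 1, i}
      = insert k (Finset.Icc 1 (N - 1) \ {k, i - 1, i}) := by
    ext l; simp only [Finset.mem_sdiff, Finset.mem_insert, Finset.mem_singleton, Finset.mem_Icc]
    omega
  have h3 : ∑ j ∈ Finset.Icc 1 (N - 1) \ {i - 1, i}, Γ (x k - x j)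
      = Γ 0 + ∑ j ∈ Finset.Icc 1 (N - 1) \ {k, i - 1, i}, Γ (x k - x j) := by
    rw [h, Finset.sum_insert (by simp), sub_self]
  simp only [sub_zero, neg_zero, h3]
  ring

theorem cyclicField_zero : cyclicField N Γ x 0 = 0 := by
  simp [cyclicField, cyclicExt_zero]

theorem cyclicField_self (hN : 0 < N) (hper : ∀ θ : ℝ, Γ (θ + 2 * π) = Γ θ) :
    cyclicField N Γ x N = 0 := by
  rw [cyclicField, cyclicExt_self hN, sub_eq_zero]
  refine Finset.sum_congr rfl fun j _ => ?_
  rw [← hper (-cyclicExt N x j)]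
  congr 1
  ring

theorem sum_sign_mul_cyclicField_neg (hN : 3 ≤ N) (hi : 2 ≤ i) (hi' : i < N)
    (hper : ∀ θ : ℝ, Γ (θ + 2 * π) = Γ θ)
    (hd1 : ∀ θ ∈ Ioo (0 : ℝ) (2 * π), HasDerivAt Γ (Γ' θ) θ)
    (hd2 : ∀ θ ∈ Ioo (0 : ℝ) (2 * π), HasDerivAt Γ' (Γ'' θ) θ)
    (hneg : ∀ θ ∈ Ioo (0 : ℝ) (2 * π), Γ' θ < 0)
    (hcurv : (∀ θ ∈ Ioo (0 : ℝ) (2 * π), 0 ≤ Γ'' θ) ∨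
      (∀ θ ∈ Ioo (0 : ℝ) (2 * π), Γ'' θ ≤ 0))
    (hx : inConeRedi N i x) (hy : inConeRedi N i y)
    (hne : ∃ k ∈ Finset.Icc 1 (N - 1), x k ≠ y k) {s : ℕ → ℝ} (hs : ∀ k, |s k| ≤ 1)
    (hse : ∀ k < N, s k * (cyclicExt N x (k + 1) - cyclicExt N y (k + 1)
        - (cyclicExt N x k - cyclicExt N y k))
      = |cyclicExt N x (k + 1) - cyclicExt N y (k + 1)
        - (cyclicExt N x k - cyclicExt N y k)|) :
    ∑ k ∈ Finset.range N, s k * (cyclicField N Γ x (k + 1) - cyclicField N Γ y (k + 1)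
      - (cyclicField N Γ x k - cyclicField N Γ y k)) < 0 := by
  set X := cyclicExt N x with hX
  set Y := cyclicExt N y with hY
  have hN0 : 0 < N := by omega
  have hXN : ∀ k, X (k + N) = X k + 2 * π := cyclicExt_add hN0 x
  have hYN : ∀ k, Y (k + N) = Y k + 2 * π := cyclicExt_add hN0 y
  have hXN1 : ∀ k, X (k + N + 1) = X (k + 1) + 2 * π := fun k => by
    rw [← hXN]; congr 1; omega
  have hYN1 : ∀ k, Y (k + N + 1) = Y (k + 1) + 2 * π := fun k => by
    rw [← hYN]; congr 1; omega
  have hse' : ∀ k, s (k % N) * (X (k + 1) - Y (k + 1) - (X k - Y k))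
      = |X (k + 1) - Y (k + 1) - (X k - Y k)| := by
    intro k
    induction k using Nat.strong_induction_on with
    | _ k ih =>
      rcases Nat.lt_or_ge k N with hk | hk
      · rw [Nat.mod_eq_of_lt hk]; exact hse k hk
      · obtain ⟨m, rfl⟩ := Nat.exists_eq_add_of_le' hk
        have := ih m (by omega)
        rw [Nat.add_mod_right, hXN, hYN, hXN1, hYN1]
        simpa only [add_sub_add_right_eq_sub] using this
  have hshift : ∀ u v : ℝ, Γ (u + 2 * π - v) = Γ (u - v) := fun u v => by
    rw [← hper (u - v)]; congr 1; ring
  have hpos : ∀ j < N, 0 < ∑ k ∈ Finset.range N,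
      s k * (Γ (Y (k + 1) - Y j) - Γ (X (k + 1) - X j) - (Γ (Y k - Y j) - Γ (X k - X j))) := by
    intro j hj
    have hsum := sum_range_add_eq_of_periodic (N := N)
      (F := fun k => s (k % N) * (Γ (Y (k + 1) - Y j) - Γ (X (k + 1) - X j)
        - (Γ (Y k - Y j) - Γ (X k - X j))))
      (fun k => by simp only [Nat.add_mod_right, hXN, hYN, hXN1, hYN1, hshift]) j
    have hmod : ∑ k ∈ Finset.range N,
        s k * (Γ (Y (k + 1) - Y j) - Γ (X (k + 1) - X j) - (Γ (Y k - Y j) - Γ (X k - X j)))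
        = ∑ k ∈ Finset.range N, s (k % N) * (Γ (Y (k + 1) - Y j) - Γ (X (k + 1) - X j)
          - (Γ (Y k - Y j) - Γ (X k - X j))) :=
      Finset.sum_congr rfl fun k hk => by rw [Nat.mod_eq_of_lt (Finset.mem_range.1 hk)]
    rw [hmod, ← hsum]
    have hXm := cyclicExt_monotone hN hx hi hi'
    have hYm := cyclicExt_monotone hN hy hi hi'
    refine signed_coupling_increments_pos hd1 hd2 hneg hcurv
      (a := fun m => X (j + m) - X j) (b := fun m => Y (j + m) - Y j)
      (s := fun m => s ((j + m) % N)) (n := N)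
      (lo := if j = i - 1 then 2 else 1) (hi := if j = i then N - 2 else N - 1)
      (by split_ifs <;> omega) (by split_ifs <;> omega) (by split_ifs <;> omega)
      (fun p q hpq => sub_le_sub_right (hXm (by omega)) _)
      (fun p q hpq => sub_le_sub_right (hYm (by omega)) _) ?_ ?_ (fun m => hs _) ?_ ?_
    · intro m hlo hhi
      have hm0 : 0 < m := by split_ifs at hlo <;> omega
      have hmN : m < N := by split_ifs at hhi <;> omega
      have h1 : j = i - 1 → 2 ≤ m := fun h => by simpa [h] using hlo
      have h2 : j = i → m + 2 ≤ N := fun h => by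
        rw [if_pos h] at hhi; omega
      exact ⟨cyclicExt_sub_mem_Ioo hN hx hi hi' hj hm0 hmN h1 h2,
        cyclicExt_sub_mem_Ioo hN hy hi hi' hj hm0 hmN h1 h2⟩
    · intro m hm hout
      have hcases : m = 0 ∨ m = N ∨ (j = i - 1 ∧ m = 1) ∨ (j = i ∧ m = N - 1) := by
        split_ifs at hout <;> omega
      have hXi : X i = X (i - 1) := cyclicExt_step_eq hx hi hi'
      have hYi : Y i = Y (i - 1) := cyclicExt_step_eq hy hi hi'
      rcases hcases with rfl | rfl | ⟨rfl, rfl⟩ | ⟨rfl, rfl⟩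
      · simp
      · simp [hXN, hYN]
      · simp only [show i - 1 + 1 = i by omega, hXi, hYi, sub_self]
      · simp only [show j + (N - 1) = j - 1 + N by omega, hXN, hYN, hXi, hYi,
          add_sub_cancel_left]
    · intro m
      have := hse' (j + m)
      convert this using 2 <;> ring_nf
    · by_contra! hcon
      obtain ⟨k, hk, hxy⟩ := hne
      rw [Finset.mem_Icc] at hk
      have hall : ∀ l, j ≤ l → l ≤ j + N → X l - Y l = X j - Y j := by
        intro l h1 h2
        have := hcon (l - j) (by omega)
        rw [show j + (l - j) = l by omega] at this
        linarith
      have hN' := hall N (by omega) (by omega)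
      have hXNN : X N = 2 * π := cyclicExt_self hN0
      have hYNN : Y N = 2 * π := cyclicExt_self hN0
      have hzero : X k - Y k = 0 := by
        rcases le_total j k with h | h
        · have := hall k h (by omega)
          linarith
        · have := hall (k + N) (by omega) (by omega)
          rw [hXN, hYN] at this
          linarith
      rw [hX, hY, cyclicExt_of_lt (by omega) (by omega),
        cyclicExt_of_lt (by omega) (by omega)] at hzero
      exact hxy (sub_eq_zero.1 hzero)
  have hswap : ∑ k ∈ Finset.range N, s k * (cyclicField N Γ x (k + 1) - cyclicField N Γ y (k + 1)
      - (cyclicField N Γ x k - cyclicField N Γ y k))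
      = -∑ j ∈ Finset.range N, ∑ k ∈ Finset.range N,
        s k * (Γ (Y (k + 1) - Y j) - Γ (X (k + 1) - X j) - (Γ (Y k - Y j) - Γ (X k - X j))) := by
    rw [Finset.sum_comm, ← Finset.sum_neg_distrib]
    refine Finset.sum_congr rfl fun k _ => ?_
    rw [← Finset.mul_sum]
    simp only [Finset.sum_sub_distrib, cyclicField]
    ring
  rw [hswap, neg_lt_zero]
  exact Finset.sum_pos (fun j hj => hpos j (Finset.mem_range.1 hj))
    ⟨0, Finset.mem_range.2 hN0⟩

theorem dist1_eq_sum_cyclicExt (hN : 3 ≤ N) :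
    dist1 1 (N - 1) x y = ∑ k ∈ Finset.range N, |cyclicExt N x (k + 1) - cyclicExt N y (k + 1)
      - (cyclicExt N x k - cyclicExt N y k)| := by
  obtain ⟨n, rfl⟩ := Nat.exists_eq_add_of_le' (show 2 ≤ N by omega)
  rw [Finset.sum_range_succ, Finset.sum_range_succ', dist1, cyclicExt_self (by omega),
    cyclicExt_self (by omega), cyclicExt_zero, cyclicExt_zero]
  have hmid : ∑ k ∈ Finset.range n,
      |cyclicExt (n + 2) x (k + 1 + 1) - cyclicExt (n + 2) y (k + 1 + 1)
        - (cyclicExt (n + 2) x (k + 1) - cyclicExt (n + 2) y (k + 1))|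
      = ∑ j ∈ Finset.Icc 1 (n + 2 - 1 - 1), |x (j + 1) - y (j + 1) - (x j - y j)| := by
    rw [show Finset.Icc 1 (n + 2 - 1 - 1) = Finset.Ico 1 (n + 1) by
      ext k; simp only [Finset.mem_Icc, Finset.mem_Ico]; omega, Finset.sum_Ico_eq_sum_range]
    refine Finset.sum_congr rfl fun k hk => ?_
    rw [Finset.mem_range] at hk
    simp only [cyclicExt_of_lt (N := n + 2) (show 0 < k + 1 by omega) (by omega),
      cyclicExt_of_lt (N := n + 2) (show 0 < k + 1 + 1 by omega) (by omega),
      add_comm 1 k]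
  rw [hmid]
  simp only [zero_add, cyclicExt_of_lt (N := n + 2) one_pos (by omega),
    cyclicExt_of_lt (N := n + 2) (show 0 < n + 1 by omega) (by omega),
    show n + 2 - 1 = n + 1 by omega, sub_self, sub_zero, zero_sub, abs_neg]
  ring

theorem hasDerivWithinAt_cyclicExt (hN : 3 ≤ N) (hi : 2 ≤ i) (hi' : i < N)
    (hper : ∀ θ : ℝ, Γ (θ + 2 * π) = Γ θ) {I : Set ℝ} {Θ : ℝ → ℕ → ℝ}
    (hsync : ∀ t ∈ I, Θ t (i - 1) = Θ t i) (hΘ : IsSolRedi N i Γ I Θ)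
    {t : ℝ} (ht : t ∈ I) {k : ℕ} (hk : k ≤ N) :
    HasDerivWithinAt (fun u => cyclicExt N (Θ u) k) (cyclicField N Γ (Θ t) k) I t := by
  have hi_deriv : HasDerivWithinAt (fun u => Θ u i) (cyclicField N Γ (Θ t) i) I t := by
    rw [← redRHSii_eq_cyclicField hN hi hi' (hsync t ht)]
    exact (hΘ.2 t ht).hasDerivWithinAt
  rcases Nat.eq_zero_or_pos k with rfl | hk0
  · simp only [cyclicExt_zero, cyclicField_zero]
    exact hasDerivWithinAt_const _ _ _
  rcases hk.eq_or_lt with rfl | hkN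
  · simp only [cyclicExt_self hk0, cyclicField_self hk0 hper]
    exact hasDerivWithinAt_const _ _ _
  simp only [cyclicExt_of_lt hk0 hkN]
  by_cases hki : k = i
  · rw [hki]; exact hi_deriv
  by_cases hki1 : k = i - 1
  · have hfield : cyclicField N Γ (Θ t) k = cyclicField N Γ (Θ t) i := by
      rw [cyclicField, cyclicField, cyclicExt_of_lt hk0 hkN,
        cyclicExt_of_lt (show 0 < i by omega) hi', hki1, hsync t ht]
    rw [hfield, hki1]
    exact hi_deriv.congr hsync (hsync t ht)
  · rw [← redRHSi_eq_cyclicField hN hi hi' (hsync t ht) hk0 hkN hki1 hki]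
    exact (hΘ.1 k (Finset.mem_Icc.2 ⟨hk0, by omega⟩) hki1 hki t ht).hasDerivWithinAt

end Cyclic

/-- Contraction of the reduced `C′ᵢ` dynamics for a decreasing coupling function. -/
theorem contraction_reducedCi_of_decreasing_coupling
    (N i : ℕ) (hN : 3 ≤ N) (hi : 2 ≤ i) (hi' : i ≤ N - 1) (Γ Γ' Γ'' : ℝ → ℝ)
    (hper : ∀ θ : ℝ, Γ (θ + 2 * π) = Γ θ)
    (hd1 : ∀ θ ∈ Ioo (0 : ℝ) (2 * π), HasDerivAt Γ (Γ' θ) θ)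
    (hd2 : ∀ θ ∈ Ioo (0 : ℝ) (2 * π), HasDerivAt Γ' (Γ'' θ) θ)
    (hmono : ∀ θ ∈ Ioo (0 : ℝ) (2 * π), Γ' θ < 0)
    (hcurv : (∀ θ ∈ Ioo (0 : ℝ) (2 * π), 0 ≤ Γ'' θ) ∨
      (∀ θ ∈ Ioo (0 : ℝ) (2 * π), Γ'' θ ≤ 0))
    (I : Set ℝ) (hI : I.OrdConnected)
    (Θ Ψ : ℝ → ℕ → ℝ)
    (hΘsync : ∀ t ∈ I, Θ t (i - 1) = Θ t i) (hΨsync : ∀ t ∈ I, Ψ t (i - 1) = Ψ t i)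
    (hΘ : IsSolRedi N i Γ I Θ) (hΨ : IsSolRedi N i Γ I Ψ)
    (hΘC : ∀ t ∈ I, inConeRedi N i (Θ t)) (hΨC : ∀ t ∈ I, inConeRedi N i (Ψ t))
    (hne : ∀ t ∈ I, ∃ k ∈ Finset.Icc 1 (N - 1), Θ t k ≠ Ψ t k) :
    ∀ t₁ ∈ I, ∀ t₂ ∈ I, t₁ < t₂ →
      dist1 1 (N - 1) (Θ t₂) (Ψ t₂) < dist1 1 (N - 1) (Θ t₁) (Ψ t₁) := by
  intro t₁ ht₁ t₂ ht₂ hlt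
  have hiN : i < N := by omega
  have hsub : Icc t₁ t₂ ⊆ I := hI.out ht₁ ht₂
  set d : ℕ → ℝ → ℝ := fun k u =>
    cyclicExt N (Θ u) (k + 1) - cyclicExt N (Ψ u) (k + 1)
      - (cyclicExt N (Θ u) k - cyclicExt N (Ψ u) k) with hd
  set d' : ℕ → ℝ → ℝ := fun k u =>
    cyclicField N Γ (Θ u) (k + 1) - cyclicField N Γ (Ψ u) (k + 1)
      - (cyclicField N Γ (Θ u) k - cyclicField N Γ (Ψ u) k) with hd'
  have hder : ∀ k < N, ∀ t ∈ I, HasDerivWithinAt (d k) (d' k t) I t := by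
    intro k hk t ht
    have h1 : ∀ l ≤ N, _ := fun l hl =>
      hasDerivWithinAt_cyclicExt (k := l) hN hi hiN hper hΘsync hΘ ht hl
    have h2 : ∀ l ≤ N, _ := fun l hl =>
      hasDerivWithinAt_cyclicExt (k := l) hN hi hiN hper hΨsync hΨ ht hl
    exact ((h1 (k + 1) hk).sub (h2 (k + 1) hk)).sub ((h1 k hk.le).sub (h2 k hk.le))
  have hright : ∀ k < N, ∀ t ∈ Ico t₁ t₂, HasDerivWithinAt (d k) (d' k t) (Ici t) t := by
    intro k hk t ht
    refine ((hder k hk t (hsub (Ico_subset_Icc_self ht))).mono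
      ((Icc_subset_Icc_left ht.1).trans hsub)).mono_of_mem_nhdsWithin ?_
    exact Icc_mem_nhdsGE ht.2
  have hsign : ∀ t ∈ Ico t₁ t₂, ∃ s : ℕ → ℝ, (∀ k, |s k| ≤ 1) ∧ ∀ k < N,
      s k * d k t = |d k t| ∧
        HasDerivWithinAt (fun u => |d k u|) (s k * d' k t) (Ici t) t := by
    intro t ht
    have h : ∀ k, ∃ s : ℝ, |s| ≤ 1 ∧ (k < N → s * d k t = |d k t| ∧
        HasDerivWithinAt (fun u => |d k u|) (s * d' k t) (Ici t) t) := by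
      intro k
      by_cases hk : k < N
      · obtain ⟨s, h1, h2⟩ := exists_sign_hasDerivWithinAt_abs (hright k hk t ht)
        exact ⟨s, h1, fun _ => h2⟩
      · exact ⟨0, by simp, fun h => absurd h hk⟩
    choose s hs1 hs2 using h
    exact ⟨s, hs1, hs2⟩
  have hf : ∀ t ∈ Ico t₁ t₂, ∃ f' < 0,
      HasDerivWithinAt (fun u => ∑ k ∈ Finset.range N, |d k u|) f' (Ici t) t := by
    intro t ht
    obtain ⟨s, hs1, hs2⟩ := hsign t ht
    have htI := hsub (Ico_subset_Icc_self ht)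
    exact ⟨_, sum_sign_mul_cyclicField_neg hN hi hiN hper hd1 hd2 hmono hcurv
      (hΘC t htI) (hΨC t htI) (hne t htI) hs1 fun k hk => (hs2 k hk).1,
      HasDerivWithinAt.fun_sum fun k hk => (hs2 k (Finset.mem_range.1 hk)).2⟩
  choose! f' hneg hderiv using hf
  rw [dist1_eq_sum_cyclicExt hN, dist1_eq_sum_cyclicExt hN]
  refine lt_of_right_deriv_neg (f := fun u => ∑ k ∈ Finset.range N, |d k u|) hlt ?_ hderiv hneg
  refine continuousOn_finsetSum _ fun k hk t ht => ?_
  exact ((hder k (Finset.mem_range.1 hk) t (hsub ht)).continuousWithinAt.mono hsub).abs
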